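/- Let q∈(q_KL,3). Then there exists n∈ℕ such that, with a_n=0λ_1⋯λ_{2^n−1} and b_n=(−1)λ_1⋯λ_{2^n−1}, every infinite concatenation of blocks from the alphabet {a_n, b_n, 𝑎̄_n, 𝑏̄_n} in which every consecutive pair of blocks is one of the allowed transitions a_n→b_n, a_n→𝑎̄_n, b_n→𝑎̄_n, 𝑎̄_n→a_n, 𝑎̄_n→𝑏̄_n, 𝑏̄_n→a_n, belongs to U_q'. -/

import Mathlib

open scoped Pointwise ENNReal
open Filter

noncomputable section

/-- The digit set Ω₁ = {(0,0),(0,1),(1,0)} ⊆ ℝ². -/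
def Omega1 : Set (ℝ × ℝ) := {((0:ℝ), (0:ℝ)), (0, 1), (1, 0)}

/-- The digit set Ω₂ = Ω₁ − Ω₁ ⊆ ℝ². -/
def Omega2 : Set (ℝ × ℝ) :=
  {((0:ℝ), (0:ℝ)), (0, 1), (1, 0), (-1, 0), (-1, 1), (0, -1), (1, -1)}

/-- The Sierpinski gasket in base `q`. -/
def gasket (q : ℝ) : Set (ℝ × ℝ) :=
  {x | ∃ c : ℕ → ℝ × ℝ, (∀ i, c i ∈ Omega1) ∧ x = ∑' i, (q ^ (i + 1))⁻¹ • c i}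

/-- `U_q`: points of `[-1/(q-1), 1/(q-1)]` having a unique `q`-expansion over `{-1,0,1}`. -/
def uniqSet (q : ℝ) : Set ℝ :=
  {s | s ∈ Set.Icc (-(1 / (q - 1))) (1 / (q - 1)) ∧
    ∃! t : ℕ → ℝ, (∀ i, t i ∈ ({-1, 0, 1} : Set ℝ)) ∧ s = ∑' i, t i / q ^ (i + 1)}

/-- The set `T`. -/
def Tset (q : ℝ) : Set (ℝ × ℝ) :=
  {t | t ∈ gasket q - gasket q ∧ t.1 ∈ uniqSet q ∧ t.2 ∈ uniqSet q}

/-- The set `D_q` of Hausdorff dimensions of intersections. -/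
def Dset (q : ℝ) : Set ℝ≥0∞ :=
  {d | ∃ t ∈ Tset q, d = dimH (gasket q ∩ ((· + t) '' gasket q))}

/-- The words `w_n` over `{0,1,2}`: `klWord 0 = w₁ = 2`,
`w_{n+1} = (w_n ⟨reflection of w_n⟩)⁺`. -/
def klWord : ℕ → List ℕ
  | 0 => [2]
  | n + 1 =>
    let w := klWord n ++ (klWord n).map (fun x => 2 - x)
    w.dropLast ++ [w.getLast?.getD 0 + 1]

/-- `isKLBase n p`: `p ∈ (2,3)` and `1` has (greedy) expansion `w_n 0^∞` in base `p`
w.r.t. `{0,1,2}`, i.e. `p = q_n`. -/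
def isKLBase (n : ℕ) (p : ℝ) : Prop :=
  p ∈ Set.Ioo (2 : ℝ) 3 ∧
    (1 : ℝ) = ∑ i ∈ Finset.range (klWord (n - 1)).length,
      ((klWord (n - 1)).getD i 0 : ℝ) / p ^ (i + 1)

/-- `1` has a unique expansion in base `p` w.r.t. the digit set `{0,1,2}`. -/
def uniqueOneExp (p : ℝ) : Prop :=
  ∃! c : ℕ → ℕ, (∀ i, c i ≤ 2) ∧ (1 : ℝ) = ∑' i, (c i : ℝ) / p ^ (i + 1)

/-- The Thue–Morse sequence. -/
def tm : ℕ → ℕ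
  | 0 => 0
  | n + 1 => if (n + 1) % 2 = 0 then tm ((n + 1) / 2) else 1 - tm ((n + 1) / 2)
decreasing_by all_goals omega

/-- `λ_i = τ_i − τ_{i−1}` (for `i ≥ 1`). -/
def lam (i : ℕ) : ℤ := (tm i : ℤ) - (tm (i - 1) : ℤ)

/-- The word `ε_n = λ₁ ⋯ λ_{2^n}`. -/
def eps (n : ℕ) : List ℤ := (List.range (2 ^ n)).map fun i => lam (i + 1)

/-- Reflection of a word over `{-1,0,1}`: each digit `x` is replaced by `-x`. -/
def reflect (w : List ℤ) : List ℤ := w.map fun x => -x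

/-- `w⁺`: the last digit is increased by `1`. -/
def plusOne (w : List ℤ) : List ℤ := w.dropLast ++ [w.getLast?.getD 0 + 1]

/-- `w⁻`: the last digit is decreased by `1`. -/
def minusOne (w : List ℤ) : List ℤ := w.dropLast ++ [w.getLast?.getD 0 - 1]

/-- The periodic sequence `w^∞` (the `(j+1)`-st term is `per w j`). -/
def per (w : List ℤ) : ℕ → ℤ := fun j => w.getD (j % w.length) 0

/-- `EndsWith x s`: the sequence `x` ends with (has tail) the sequence `s`. -/
def EndsWith {α : Type*} (x s : ℕ → α) : Prop := ∃ k, ∀ j, x (j + k) = s j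

/-- The digit set Ω₂ as a subset of ℤ × ℤ. -/
def Omega2Z : Set (ℤ × ℤ) :=
  {((0:ℤ), (0:ℤ)), (0, 1), (1, 0), (-1, 0), (-1, 1), (0, -1), (1, -1)}

/-- `E_{n,m}^i = (σ^i((ε_n ε̄_n)^∞), (ε_m ε̄_m)^∞)` (the `(j+1)`-st term is `Eseq n m i j`). -/
def Eseq (n m i : ℕ) : ℕ → ℤ × ℤ := fun j =>
  (per (eps n ++ reflect (eps n)) (j + i), per (eps m ++ reflect (eps m)) j)


/-- `A_k = a₁ ⋯ a_{2^k}` where `a_i = λ_{2i−1}`. -/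
def Aword (k : ℕ) : List ℤ := (List.range (2 ^ k)).map fun i => lam (2 * i + 1)

/-- `D_{k,k}^i = (σ^i((A_k Ā_k)^∞), (A_k Ā_k)^∞)`. -/
def Dseq (k i : ℕ) : ℕ → ℤ × ℤ := fun j =>
  (per (Aword k ++ reflect (Aword k)) (j + i), per (Aword k ++ reflect (Aword k)) j)

/-- `U_q'`: the set of sequences over `{-1,0,1}` which are the unique `q`-expansion
of the number they represent. -/
def uniqSeqSet (q : ℝ) : Set (ℕ → ℤ) :=
  {t | (∀ i, t i ∈ ({-1, 0, 1} : Set ℤ)) ∧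
    ∀ s : ℕ → ℤ, (∀ i, s i ∈ ({-1, 0, 1} : Set ℤ)) →
      (∑' i, (s i : ℝ) / q ^ (i + 1)) = (∑' i, (t i : ℝ) / q ^ (i + 1)) → s = t}

/-- `ε_{n-1} ε̄_{n-1}`, with the convention `ε_{-1} ε̄_{-1} := 00`. -/
def epsPair : ℕ → List ℤ
  | 0 => [0, 0]
  | n + 1 => eps n ++ reflect (eps n)

/-- The finite prefix
`(ε_0 ε̄_0)^{j_0} (ε_0 ε̄_1)^{l_0} ⋯ (ε_{M-1} ε̄_{M-1})^{j_{M-1}} (ε_{M-1} ε̄_M)^{l_{M-1}}`. -/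
def blockJL (j l : ℕ → ℕ) : ℕ → List ℤ
  | 0 => []
  | M + 1 => blockJL j l M
      ++ (List.replicate (j M) (eps M ++ reflect (eps M))).flatten
      ++ (List.replicate (l M) (eps M ++ reflect (eps (M + 1)))).flatten

/-- The tail of `t` starting at some position `k` follows the pattern
`(ε_0 ε̄_0)^{j_0}(ε_0 ε̄_1)^{l_0}(ε_1 ε̄_1)^{j_1}(ε_1 ε̄_2)^{l_1}⋯`. -/
def TailFollows (t : ℕ → ℤ) (j l : ℕ → ℕ) : Prop :=
  ∃ k, ∀ M, ∀ i < (blockJL j l M).length, t (i + k) = (blockJL j l M).getD i 0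

/-- As `TailFollows`, but for the reflection of the pattern. -/
def TailFollowsRefl (t : ℕ → ℤ) (j l : ℕ → ℕ) : Prop :=
  ∃ k, ∀ M, ∀ i < (blockJL j l M).length, t (i + k) = -(blockJL j l M).getD i 0

/-- `a_n = 0 λ₁ ⋯ λ_{2^n−1}`. -/
def aword (n : ℕ) : List ℤ := 0 :: ((List.range (2 ^ n - 1)).map fun i => lam (i + 1))

/-- `b_n = (−1) λ₁ ⋯ λ_{2^n−1}`. -/
def bword (n : ℕ) : List ℤ := (-1) :: ((List.range (2 ^ n - 1)).map fun i => lam (i + 1))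

/-- The transitions allowed by the matrix `A` on the alphabet `{a_n, b_n, ā_n, b̄_n}`:
`a→b, a→ā, b→ā, ā→a, ā→b̄, b̄→a`. -/
def allowedTrans (n : ℕ) (u v : List ℤ) : Prop :=
  (u = aword n ∧ (v = bword n ∨ v = reflect (aword n))) ∨
  (u = bword n ∧ v = reflect (aword n)) ∨
  (u = reflect (aword n) ∧ (v = aword n ∨ v = reflect (bword n))) ∨
  (u = reflect (bword n) ∧ v = aword n)

/-! ### The Thue–Morse sequence and the sequence `lam` -/

lemma tm_two_mul (i : ℕ) : tm (2 * i) = tm i := by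
  cases i with
  | zero => rfl
  | succ k =>
    rw [show 2 * (k + 1) = (2 * k + 1) + 1 by ring, tm, if_pos (by omega)]
    congr 1
    omega

lemma tm_two_mul_add_one (i : ℕ) : tm (2 * i + 1) = 1 - tm i := by
  rw [tm, if_neg (by omega)]
  congr 2
  omega

lemma tm_le_one (i : ℕ) : tm i ≤ 1 := by
  induction i using Nat.strong_induction_on with
  | _ i ih =>
    rcases Nat.even_or_odd' i with ⟨k, rfl | rfl⟩
    · rcases k.eq_zero_or_pos with rfl | hk
      · simp [tm]
      · rw [tm_two_mul]
        exact ih k (by omega)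
    · rw [tm_two_mul_add_one]
      omega

lemma tm_zero : tm 0 = 0 := by rw [tm]

lemma tm_one : tm 1 = 1 := by simpa [tm_zero] using tm_two_mul_add_one 0

lemma tm_two_pow_add (n i : ℕ) (hi : i < 2 ^ n) : tm (2 ^ n + i) = 1 - tm i := by
  induction n generalizing i with
  | zero =>
    obtain rfl : i = 0 := by simpa using hi
    simp [tm_zero, tm_one]
  | succ n ih =>
    have h2 : 2 ^ (n + 1) = 2 * 2 ^ n := by ring
    rcases Nat.even_or_odd' i with ⟨k, rfl | rfl⟩
    · rw [show 2 ^ (n + 1) + 2 * k = 2 * (2 ^ n + k) by ring, tm_two_mul, tm_two_mul,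
        ih k (by omega)]
    · rw [show 2 ^ (n + 1) + (2 * k + 1) = 2 * (2 ^ n + k) + 1 by ring, tm_two_mul_add_one,
        tm_two_mul_add_one, ih k (by omega)]

lemma tm_two_pow_sub_one (n : ℕ) : tm (2 ^ n - 1) = n % 2 := by
  induction n with
  | zero => simp [tm_zero]
  | succ n ih =>
    have h2 : 2 ^ (n + 1) = 2 * 2 ^ n := by ring
    have := Nat.one_le_two_pow (n := n)
    rw [show 2 ^ (n + 1) - 1 = 2 * (2 ^ n - 1) + 1 by omega, tm_two_mul_add_one, ih]
    omega

lemma lam_succ (i : ℕ) : lam (i + 1) = (tm (i + 1) : ℤ) - tm i := by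
  simp [lam]

lemma lam_one : lam 1 = 1 := by simp [lam, tm_one, tm_zero]

lemma lam_two_pow_add (n i : ℕ) (h0 : 0 < i) (hi : i < 2 ^ n) : lam (2 ^ n + i) = -lam i := by
  obtain ⟨k, rfl⟩ : ∃ k, i = k + 1 := ⟨i - 1, by omega⟩
  rw [← add_assoc, lam_succ, lam_succ, add_assoc, tm_two_pow_add n _ hi,
    tm_two_pow_add n k (by omega)]
  have := tm_le_one k
  have := tm_le_one (k + 1)
  omega

lemma lam_two_pow (n : ℕ) : lam (2 ^ n) = 1 - ((n % 2 : ℕ) : ℤ) := by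
  have h : tm (2 ^ n) = 1 := by simpa [tm_zero] using tm_two_pow_add n 0 (by positivity)
  simp [lam, h, tm_two_pow_sub_one]

lemma lam_mem (i : ℕ) : lam i ∈ ({-1, 0, 1} : Set ℤ) := by
  have := tm_le_one i
  have := tm_le_one (i - 1)
  simp only [lam, Set.mem_insert_iff, Set.mem_singleton_iff]
  omega

/-! ### Lexicographic comparison of sequences -/

/-- `x` does not exceed `y` lexicographically on the first `N` digits. -/
def LexLEUpTo (N : ℕ) (x y : ℕ → ℤ) : Prop :=
  ∀ j < N, (∀ i < j, x i = y i) → x j ≤ y j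

lemma LexLEUpTo.trans {N : ℕ} {x y z : ℕ → ℤ} (hxy : LexLEUpTo N x y) (hyz : LexLEUpTo N y z) :
    LexLEUpTo N x z := by
  intro j hj h
  have hy : ∀ i ≤ j, ∀ l < i, y l = z l := by
    intro i
    induction i with
    | zero => intro _ l hl; omega
    | succ i ih =>
      intro hi l hl
      rcases Nat.lt_succ_iff_lt_or_eq.1 hl with h' | rfl
      · exact ih (by omega) l h'
      · have hl' := ih (by omega)
        have h1 := hyz l (by omega) hl'
        have h2 := hxy l (by omega) fun m hm => (h m (by omega)).trans (hl' m hm).symm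
        have h3 := h l (by omega)
        omega
  have hj' := hy j le_rfl
  exact (hxy j hj fun m hm => (h m hm).trans (hj' m hm).symm).trans (hyz j hj hj')

/-- A sequence of zeros and ones whose tails starting with `0` do not exceed the Thue–Morse
sequence; preserved by the Thue–Morse substitution `0 ↦ 01`, `1 ↦ 10`. -/
def TMBounded (N : ℕ) (w : ℕ → ℤ) : Prop :=
  ∀ k, w k = 0 → LexLEUpTo N (fun i => w (k + i)) fun i => tm i

/-- The `n`-fold image of `s` under the Thue–Morse substitution `0 ↦ 01`, `1 ↦ 10`. -/
def tmSubst (s : ℕ → ℤ) : ℕ → ℕ → ℤ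
  | 0, j => s j
  | n + 1, j => if j % 2 = 0 then tmSubst s n (j / 2) else 1 - tmSubst s n (j / 2)

lemma tmSubst_two_mul (s : ℕ → ℤ) (n j : ℕ) : tmSubst s (n + 1) (2 * j) = tmSubst s n j := by
  simp [tmSubst]

lemma tmSubst_two_mul_add_one (s : ℕ → ℤ) (n j : ℕ) :
    tmSubst s (n + 1) (2 * j + 1) = 1 - tmSubst s n j := by
  rw [tmSubst, if_neg (by omega), show (2 * j + 1) / 2 = j by omega]

lemma tmSubst_zero_or_one {s : ℕ → ℤ} (hs : ∀ k, s k = 0 ∨ s k = 1) (n j : ℕ) :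
    tmSubst s n j = 0 ∨ tmSubst s n j = 1 := by
  induction n generalizing j with
  | zero => exact hs j
  | succ n ih =>
    rcases Nat.even_or_odd' j with ⟨k, rfl | rfl⟩
    · rw [tmSubst_two_mul]
      exact ih k
    · rw [tmSubst_two_mul_add_one]
      rcases ih k with h | h <;> simp [h]

lemma tmSubst_one_sub (s : ℕ → ℤ) (n j : ℕ) :
    tmSubst (fun k => 1 - s k) n j = 1 - tmSubst s n j := by
  induction n generalizing j with
  | zero => rfl
  | succ n ih =>
    rcases Nat.even_or_odd' j with ⟨k, rfl | rfl⟩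
    · rw [tmSubst_two_mul, tmSubst_two_mul, ih]
    · rw [tmSubst_two_mul_add_one, tmSubst_two_mul_add_one, ih]

lemma tmSubst_apply (s : ℕ → ℤ) (n k i : ℕ) (hi : i < 2 ^ n) :
    tmSubst s n (2 ^ n * k + i) = s k + (1 - 2 * s k) * tm i := by
  induction n generalizing i with
  | zero =>
    obtain rfl : i = 0 := by simpa using hi
    simp [tmSubst, tm_zero]
  | succ n ih =>
    have h2 : 2 ^ (n + 1) = 2 * 2 ^ n := by ring
    rcases Nat.even_or_odd' i with ⟨l, rfl | rfl⟩
    · rw [show 2 ^ (n + 1) * k + 2 * l = 2 * (2 ^ n * k + l) by ring, tmSubst_two_mul, tm_two_mul,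
        ih l (by omega)]
    · rw [show 2 ^ (n + 1) * k + (2 * l + 1) = 2 * (2 ^ n * k + l) + 1 by ring,
        tmSubst_two_mul_add_one, tm_two_mul_add_one, ih l (by omega),
        Nat.cast_sub (tm_le_one l)]
      push_cast
      ring

lemma tmBounded_tmSubst {s : ℕ → ℤ} (hs : ∀ k, s k = 0 ∨ s k = 1) (n : ℕ) :
    TMBounded (2 ^ n) (tmSubst s n) := by
  induction n with
  | zero =>
    intro k hk j hj _
    obtain rfl : j = 0 := by simpa using hj
    simp [hk]
  | succ n ih =>
    have hp : 2 ^ (n + 1) = 2 * 2 ^ n := by ring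
    have h01 := tmSubst_zero_or_one hs (n + 1)
    intro k hk j hj h
    simp only at h ⊢
    rcases Nat.even_or_odd' k with ⟨k, rfl | rfl⟩
    · rw [tmSubst_two_mul] at hk
      rcases Nat.even_or_odd' j with ⟨j, rfl | rfl⟩
      · rw [← mul_add, tmSubst_two_mul, tm_two_mul]
        refine ih k hk j (by omega) fun i hi => ?_
        have := h (2 * i) (by omega)
        rwa [← mul_add, tmSubst_two_mul, tm_two_mul] at this
      · have h' := h (2 * j) (by omega)
        rw [← mul_add, tmSubst_two_mul, tm_two_mul] at h'
        rw [← add_assoc, ← mul_add, tmSubst_two_mul_add_one, tm_two_mul_add_one, h',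
          Nat.cast_sub (tm_le_one j)]
        simp
    · have t2 : tm 2 = 1 := by simpa [tm_one] using tm_two_mul 1
      match j, h with
      | 0, _ => simp [hk]
      | 1, _ =>
        rw [tm_one]
        rcases h01 (2 * k + 1 + 1) with h' | h' <;> simp [h']
      | 2, _ =>
        rw [t2]
        rcases h01 (2 * k + 1 + 2) with h' | h' <;> simp [h']
      | j + 3, h =>
        have h1 := h 1 (by omega)
        have h2 := h 2 (by omega)
        rw [tm_one, show 2 * k + 1 + 1 = 2 * (k + 1) by ring, tmSubst_two_mul] at h1
        rw [t2, show 2 * k + 1 + 2 = 2 * (k + 1) + 1 by ring, tmSubst_two_mul_add_one] at h2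
        omega

lemma lexLEUpTo_lam_of_tmBounded {N : ℕ} {w x : ℕ → ℤ} (hw : ∀ k, w k = 0 ∨ w k = 1)
    (hN : TMBounded (N + 1) w) (hx : ∀ k, x (k + 1) = w (k + 1) - w k) (k : ℕ) :
    LexLEUpTo N (fun i => x (k + 1 + i)) fun i => lam (i + 1) := by
  intro j hj h
  have hx' : ∀ i, x (k + 1 + i) = w (k + (i + 1)) - w (k + i) := fun i => by
    rw [show k + 1 + i = k + i + 1 by ring, hx, add_assoc]
  simp only [hx', lam_succ] at h ⊢
  have hsum : ∀ i ≤ j, w (k + i) - w k = tm i := by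
    intro i
    induction i with
    | zero => simp [tm_zero]
    | succ i ih =>
      intro hi
      have := ih (by omega)
      have := h i (by omega)
      omega
  rcases hw k with h0 | h0
  · have := hN k h0 (j + 1) (by omega) fun i hi => by
      have := hsum i (by omega)
      simp only
      omega
    have := hsum j le_rfl
    simp only at *
    omega
  · rcases j.eq_zero_or_pos with rfl | hj0
    · have := hw (k + (0 + 1))
      simp only [zero_add, tm_one, tm_zero, add_zero] at this ⊢
      omega
    · have := hsum 1 hj0
      rw [tm_one] at this
      have := hw (k + 1)
      omega

/-- A sequence over `{-1, 0, 1}` satisfying the lexicographic characterization of unique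
expansions of `1` does not lie below `lam`. -/
lemma lexLEUpTo_lam_of_admissible {d : ℕ → ℤ} (hd : ∀ i, d i ∈ ({-1, 0, 1} : Set ℤ))
    (hup : ∀ k N, d k < 1 → LexLEUpTo N (fun i => d (k + 1 + i)) d)
    (hne : ∀ k, d k < 1 → (fun i => d (k + 1 + i)) ≠ d)
    (hlow : ∀ k N, -1 < d k → LexLEUpTo N (fun i => -d i) fun i => d (k + 1 + i)) (N : ℕ) :
    LexLEUpTo N (fun i => lam (i + 1)) d := by
  have hd' : ∀ i, d i = -1 ∨ d i = 0 ∨ d i = 1 := fun i => by simpa using hd i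
  intro m _ hm
  by_contra! hlt
  simp only at hm hlt
  obtain ⟨n, hn1, hn2⟩ : ∃ n, 2 ^ n ≤ m + 1 ∧ m + 1 < 2 ^ (n + 1) :=
    ⟨Nat.log 2 (m + 1), Nat.pow_log_le_self 2 (by omega), Nat.lt_pow_succ_log_self (by norm_num) _⟩
  have h2 : 2 ^ (n + 1) = 2 * 2 ^ n := by ring
  rcases hn1.lt_or_eq with hlt' | heq
  · have hk : -1 < d (2 ^ n - 1) := by
      rw [← hm _ (by omega), show 2 ^ n - 1 + 1 = 2 ^ n by omega, lam_two_pow]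
      omega
    have hneg : ∀ i < 2 ^ n - 1, lam (2 ^ n + i + 1) = -lam (i + 1) := fun i hi =>
      lam_two_pow_add n (i + 1) (by omega) (by omega)
    obtain ⟨r, rfl⟩ : ∃ r, m = 2 ^ n + r := ⟨m - 2 ^ n, by omega⟩
    have := hlow (2 ^ n - 1) (r + 1) hk r (by omega) fun i hi => by
      simp only
      rw [show 2 ^ n - 1 + 1 + i = 2 ^ n + i by omega, ← hm _ (by omega), ← hm _ (by omega),
        hneg i (by omega)]
    simp only at this
    rw [show 2 ^ n - 1 + 1 + r = 2 ^ n + r by omega, ← hm r (by omega)] at this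
    have := hneg r (by omega)
    omega
  · rcases n with _ | n
    · obtain rfl : m = 0 := by simpa using heq.symm
      have h0 : d 0 < 1 := hlt.trans_le (by simp [lam, tm_zero, tm_one])
      have hconst : ∀ r, ∀ i ≤ r, d i = d 0 := by
        intro r
        induction r with
        | zero => intro i hi; rw [Nat.le_zero.1 hi]
        | succ r ih =>
          intro i hi
          rcases hi.lt_or_eq with hi | rfl
          · exact ih i (by omega)
          · have ha := hup 0 (r + 1) h0 r (by omega) fun i hi => by
              simp only
              rw [ih (0 + 1 + i) (by omega), ih i (by omega)]
            have hr := ih r le_rfl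
            simp only [zero_add, add_comm 1 r] at ha
            rcases hd' 0 with h | h | h
            · have := hd' (r + 1)
              omega
            · have hb := hlow 0 (r + 1) (by omega) r (by omega) fun i hi => by
                simp only
                rw [ih (0 + 1 + i) (by omega), ih i (by omega), h, neg_zero]
              simp only [zero_add, add_comm 1 r] at hb
              omega
            · omega
      refine hne 0 h0 (funext fun i => ?_)
      rw [hconst _ (0 + 1 + i) le_rfl, hconst i i le_rfl]
    · obtain ⟨L, hL⟩ : ∃ L, 2 ^ n = L := ⟨_, rfl⟩
      have hL1 : 1 ≤ L := hL ▸ Nat.one_le_two_pow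
      have hm2 : m + 1 = 2 * L := by rw [← heq, ← hL]; ring
      have hneg : ∀ i < L - 1, lam (L + i + 1) = -lam (i + 1) := fun i hi => by
        rw [← hL]
        exact lam_two_pow_add n (i + 1) (by omega) (by omega)
      have hlamL : lam L = 1 - ((n % 2 : ℕ) : ℤ) := hL ▸ lam_two_pow n
      have hlam2L : lam (m + 1) = 1 - (((n + 1) % 2 : ℕ) : ℤ) := heq ▸ lam_two_pow (n + 1)
      have hdL : d (L - 1) = lam L := by
        rw [← hm _ (by omega), show L - 1 + 1 = L by omega]
      have hgt : -1 < d (L - 1) := by omega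
      have hshort : ∀ i < L - 1, d (L + i) = -d i := fun i hi => by
        rw [← hm _ (by omega), ← hm _ (by omega), hneg i hi]
      have hlast : d (L + (L - 1)) = -d (L - 1) := by
        have := hlow (L - 1) L hgt (L - 1) (by omega) fun i hi => by
          simp only
          rw [show L - 1 + 1 + i = L + i by omega, hshort i hi]
        simp only at this
        rw [show L - 1 + 1 + (L - 1) = L + (L - 1) by omega] at this
        have hmL : m = L + (L - 1) := by omega
        rw [hmL] at hlt hlam2L
        omega
      have hlt2 : d (L + (L - 1)) < 1 := by omega
      have hanti : ∀ r, d (L + r) = -d r := by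
        intro r
        induction r using Nat.strong_induction_on with
        | _ r ih =>
          rcases lt_trichotomy r (L - 1) with hr | rfl | hr
          · exact hshort r hr
          · exact hlast
          · have ha := hlow (L - 1) (r + 1) hgt r (by omega) fun i hi => by
              simp only
              rw [show L - 1 + 1 + i = L + i by omega, ih i hi]
            have hb := hup (L + (L - 1)) (r + 1) hlt2 (r - L) (by omega) fun i hi => by
              simp only
              rw [show L + (L - 1) + 1 + i = L + (L + i) by omega, ih (L + i) (by omega),
                ih i (by omega), neg_neg]
            have hc := ih (r - L) (by omega)
            simp only at ha hb
            rw [show L - 1 + 1 + r = L + r by omega] at ha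
            rw [show L + (L - 1) + 1 + (r - L) = L + r by omega] at hb
            rw [show L + (r - L) = r by omega] at hc
            omega
      refine hne _ hlt2 (funext fun i => ?_)
      rw [show L + (L - 1) + 1 + i = L + (L + i) by omega, hanti, hanti, neg_neg]

/-! ### Values of digit sequences -/

/-- The value `∑ x_i / q ^ i` of a digit sequence in base `q`. -/
def baseVal (q : ℝ) (x : ℕ → ℤ) : ℝ := ∑' i, (x i : ℝ) / q ^ (i + 1)

lemma hasSum_inv_pow_succ {q : ℝ} (hq : 1 < q) :
    HasSum (fun i : ℕ => 1 / q ^ (i + 1)) (1 / (q - 1)) := by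
  have h := (hasSum_geometric_of_lt_one (by positivity) (inv_lt_one_of_one_lt₀ hq)).mul_left q⁻¹
  have h0 : q ≠ 0 := by linarith
  have e1 : (fun i : ℕ => 1 / q ^ (i + 1)) = fun i => q⁻¹ * q⁻¹ ^ i := by
    funext i
    rw [pow_succ, one_div, mul_inv, inv_pow, mul_comm]
  have e2 : 1 / (q - 1) = q⁻¹ * (1 - q⁻¹)⁻¹ := by
    rw [← mul_inv, mul_sub, mul_inv_cancel₀ h0, mul_one, one_div]
  rwa [e1, e2]

section Digits

variable {q : ℝ} {x y : ℕ → ℤ}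

lemma abs_digit_le (hx : ∀ i, x i ∈ ({-1, 0, 1} : Set ℤ)) (i : ℕ) : |(x i : ℝ)| ≤ 1 := by
  have h : x i = -1 ∨ x i = 0 ∨ x i = 1 := by simpa using hx i
  rcases h with h | h | h <;> rw [h] <;> norm_num

lemma norm_digit_div_le (hq : 1 < q) (hx : ∀ i, x i ∈ ({-1, 0, 1} : Set ℤ)) (i : ℕ) :
    ‖(x i : ℝ) / q ^ (i + 1)‖ ≤ 1 / q ^ (i + 1) := by
  have : 0 < q ^ (i + 1) := by positivity
  rw [Real.norm_eq_abs, abs_div, abs_of_pos this]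
  gcongr
  exact abs_digit_le hx i

lemma summable_digit_div (hq : 1 < q) (hx : ∀ i, x i ∈ ({-1, 0, 1} : Set ℤ)) :
    Summable fun i => (x i : ℝ) / q ^ (i + 1) :=
  Summable.of_norm_bounded (hasSum_inv_pow_succ hq).summable (norm_digit_div_le hq hx)

lemma abs_baseVal_le (hq : 1 < q) (hx : ∀ i, x i ∈ ({-1, 0, 1} : Set ℤ)) :
    |baseVal q x| ≤ 1 / (q - 1) :=
  tsum_of_norm_bounded (hasSum_inv_pow_succ hq) (norm_digit_div_le hq hx)

lemma baseVal_eq_sum_add (hq : 1 < q) (hx : ∀ i, x i ∈ ({-1, 0, 1} : Set ℤ)) (j : ℕ) :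
    baseVal q x = ∑ i ∈ Finset.range j, (x i : ℝ) / q ^ (i + 1) +
      baseVal q (fun i => x (j + i)) / q ^ j := by
  rw [baseVal, ← (summable_digit_div hq hx).sum_add_tsum_nat_add j, baseVal, ← tsum_div_const]
  congr 2
  funext i
  rw [div_div, ← pow_add, add_comm i j, show i + 1 + j = j + i + 1 by ring]

lemma baseVal_eq_sum_add_digit (hq : 1 < q) (hx : ∀ i, x i ∈ ({-1, 0, 1} : Set ℤ)) (j : ℕ) :
    baseVal q x = ∑ i ∈ Finset.range j, (x i : ℝ) / q ^ (i + 1) +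
      (x j + baseVal q (fun i => x (j + 1 + i))) / q ^ (j + 1) := by
  rw [baseVal_eq_sum_add hq hx (j + 1), Finset.sum_range_succ]
  ring

lemma baseVal_sub_of_agree (hq : 1 < q) (hx : ∀ i, x i ∈ ({-1, 0, 1} : Set ℤ))
    (hy : ∀ i, y i ∈ ({-1, 0, 1} : Set ℤ)) (j : ℕ) (h : ∀ i < j, x i = y i) :
    baseVal q x - baseVal q y =
      (baseVal q (fun i => x (j + i)) - baseVal q (fun i => y (j + i))) / q ^ j := by
  rw [baseVal_eq_sum_add hq hx j, baseVal_eq_sum_add hq hy j,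
    Finset.sum_congr rfl fun i hi => by rw [h i (Finset.mem_range.1 hi)]]
  ring

lemma baseVal_sub_of_agree' (hq : 1 < q) (hx : ∀ i, x i ∈ ({-1, 0, 1} : Set ℤ))
    (hy : ∀ i, y i ∈ ({-1, 0, 1} : Set ℤ)) (j : ℕ) (h : ∀ i < j, x i = y i) :
    baseVal q x - baseVal q y = ((x j - y j : ℝ) + (baseVal q (fun i => x (j + 1 + i)) -
      baseVal q (fun i => y (j + 1 + i)))) / q ^ (j + 1) := by
  rw [baseVal_eq_sum_add_digit hq hx j, baseVal_eq_sum_add_digit hq hy j,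
    Finset.sum_congr rfl fun i hi => by rw [h i (Finset.mem_range.1 hi)]]
  ring

lemma baseVal_neg : baseVal q (fun i => -x i) = -baseVal q x := by
  rw [baseVal, baseVal, ← tsum_neg]
  congr 1
  funext i
  push_cast
  ring

lemma hasSum_digit_add_one (hq : 1 < q) (hx : ∀ i, x i ∈ ({-1, 0, 1} : Set ℤ)) :
    HasSum (fun i => ((x i : ℝ) + 1) / q ^ (i + 1)) (baseVal q x + 1 / (q - 1)) := by
  simpa only [add_div, baseVal] using (summable_digit_div hq hx).hasSum.add (hasSum_inv_pow_succ hq)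

/-- If the values of all tails are small, the expansion is unique. -/
lemma mem_uniqSeqSet_of_abs_lt (hq : 1 < q) (hx : ∀ i, x i ∈ ({-1, 0, 1} : Set ℤ))
    (h : ∀ k, |baseVal q (fun i => x (k + 1 + i))| < 1 - 1 / (q - 1)) : x ∈ uniqSeqSet q := by
  refine ⟨hx, fun s hs hsx => ?_⟩
  by_contra hne
  have hex : ∃ j, s j ≠ x j := Function.ne_iff.1 hne
  classical
  obtain ⟨j, hj, hmin⟩ : ∃ j, s j ≠ x j ∧ ∀ i < j, s i = x i :=
    ⟨Nat.find hex, Nat.find_spec hex, fun i hi => not_not.1 (Nat.find_min hex hi)⟩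
  have heq := baseVal_sub_of_agree' hq hs hx j hmin
  have h0 : baseVal q s - baseVal q x = 0 := sub_eq_zero.2 hsx
  have hqj : q ^ (j + 1) ≠ 0 := by positivity
  rw [h0, eq_comm, div_eq_zero_iff, or_iff_left hqj] at heq
  have h1 := abs_lt.1 (h j)
  have h2 := abs_le.1 (abs_baseVal_le hq fun i => hs (j + 1 + i))
  rcases lt_or_gt_of_ne hj with hlt | hlt
  · have : (s j : ℝ) + 1 ≤ x j := by exact_mod_cast hlt
    linarith
  · have : (x j : ℝ) + 1 ≤ s j := by exact_mod_cast hlt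
    linarith

/-- Every number of absolute value at most `1 / (q - 1)` has an expansion in base `q ≤ 3`. -/
lemma exists_baseVal_eq (hq : 1 < q) (hq3 : q ≤ 3) {v : ℝ} (hv : |v| ≤ 1 / (q - 1)) :
    ∃ e : ℕ → ℤ, (∀ i, e i ∈ ({-1, 0, 1} : Set ℤ)) ∧ baseVal q e = v := by
  set R := 1 / (q - 1) with hR
  have hR1 : 1 ≤ 2 * R := by
    rw [hR, mul_one_div, le_div_iff₀ (by linarith)]
    linarith
  have hqR : q * R = R + 1 := by
    have : q - 1 ≠ 0 := by linarith
    rw [hR]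
    field_simp
    ring
  have step : ∀ u : Set.Icc (-R) R, ∃ e : ℤ, e ∈ ({-1, 0, 1} : Set ℤ) ∧
      q * u - e ∈ Set.Icc (-R) R := by
    rintro ⟨u, hu1, hu2⟩
    have h1 : q * u ≤ R + 1 := hqR ▸ by gcongr
    have h2 : -(R + 1) ≤ q * u := by
      rw [← hqR]
      nlinarith
    rcases lt_or_ge R (q * u) with h | h
    · exact ⟨1, by simp, by push_cast; linarith, by push_cast; linarith⟩
    · rcases lt_or_ge (q * u) (-R) with h' | h'
      · exact ⟨-1, by simp, by push_cast; linarith, by push_cast; linarith⟩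
      · exact ⟨0, by simp, by push_cast; linarith, by push_cast; linarith⟩
  choose e he hmem using step
  let f : Set.Icc (-R) R → Set.Icc (-R) R := fun u => ⟨q * u - e u, hmem u⟩
  let r : ℕ → Set.Icc (-R) R := fun n => f^[n] ⟨v, abs_le.1 hv⟩
  have hr : ∀ n, (r (n + 1) : ℝ) = q * (r n : ℝ) - e (r n) := fun n => by
    simp only [r, Function.iterate_succ_apply', f]
  refine ⟨fun n => e (r n), fun n => he _, ?_⟩
  have hpart : ∀ n, ∑ i ∈ Finset.range n, (e (r i) : ℝ) / q ^ (i + 1) = v - r n / q ^ n := by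
    intro n
    induction n with
    | zero => simp [r]
    | succ n ih =>
      rw [Finset.sum_range_succ, ih, hr]
      have : q ≠ 0 := by positivity
      field_simp
      ring
  have hlim : Tendsto (fun n : ℕ => v - (r n : ℝ) / q ^ n) atTop (nhds (v - 0)) := by
    refine tendsto_const_nhds.sub (squeeze_zero_norm (a := fun n : ℕ => R * (q⁻¹) ^ n) ?_ ?_)
    · intro n
      have hqn : 0 < q ^ n := by positivity
      rw [Real.norm_eq_abs, abs_div, abs_of_pos hqn, inv_pow, ← div_eq_mul_inv]
      gcongr
      exact abs_le.2 (r n).2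
    · simpa using (tendsto_pow_atTop_nhds_zero_of_lt_one (by positivity)
        (inv_lt_one_of_one_lt₀ hq)).const_mul R
  rw [sub_zero] at hlim
  refine tendsto_nhds_unique (summable_digit_div hq fun n => he (r n)).hasSum.tendsto_sum_nat ?_
  simpa only [hpart] using hlim

/-- In a unique expansion, no digit can be replaced. -/
lemma lt_abs_of_mem_uniqSeqSet (hq : 1 < q) (hq3 : q ≤ 3) (hx : x ∈ uniqSeqSet q) (k : ℕ) {g : ℤ}
    (hg : g ∈ ({-1, 0, 1} : Set ℤ)) (hne : g ≠ x k) :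
    1 / (q - 1) < |baseVal q (fun i => x (k + 1 + i)) + x k - g| := by
  by_contra! hle
  obtain ⟨e, he, hev⟩ := exists_baseVal_eq hq hq3 hle
  let s : ℕ → ℤ := fun i => if i < k then x i else if i = k then g else e (i - (k + 1))
  have hs : ∀ i, s i ∈ ({-1, 0, 1} : Set ℤ) := fun i => by
    simp only [s]
    split_ifs
    exacts [hx.1 i, hg, he _]
  have hsk : s k = g := by simp [s]
  have htail : (fun i => s (k + 1 + i)) = e := funext fun i => by
    simp only [s]
    rw [if_neg (by omega), if_neg (by omega), Nat.add_sub_cancel_left]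
  have hagree : ∀ i < k, s i = x i := fun i hi => by simp [s, hi]
  have := baseVal_sub_of_agree' hq hs hx.1 k hagree
  rw [hsk, htail, hev, show (g - x k : ℝ) + (baseVal q (fun i => x (k + 1 + i)) + x k - g -
    baseVal q (fun i => x (k + 1 + i))) = 0 by ring, zero_div] at this
  exact hne (hsk ▸ congrFun (hx.2 s hs (sub_eq_zero.1 this)) k)

lemma baseVal_tail_lt (hq : 1 < q) (hq3 : q ≤ 3) (hx : x ∈ uniqSeqSet q) (k : ℕ) (h : x k < 1) :
    baseVal q (fun i => x (k + 1 + i)) < 1 - 1 / (q - 1) := by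
  have hk : x k = -1 ∨ x k = 0 ∨ x k = 1 := by simpa using hx.1 k
  have hlt := lt_abs_of_mem_uniqSeqSet hq hq3 hx k (g := x k + 1)
    (by simp only [Set.mem_insert_iff, Set.mem_singleton_iff]; omega) (by omega)
  have hb := abs_le.1 (abs_baseVal_le hq fun i => hx.1 (k + 1 + i))
  push_cast at hlt
  rcases lt_abs.1 hlt with h | h <;> linarith

lemma lt_baseVal_tail (hq : 1 < q) (hq3 : q ≤ 3) (hx : x ∈ uniqSeqSet q) (k : ℕ) (h : -1 < x k) :
    -(1 - 1 / (q - 1)) < baseVal q (fun i => x (k + 1 + i)) := by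
  have hk : x k = -1 ∨ x k = 0 ∨ x k = 1 := by simpa using hx.1 k
  have hlt := lt_abs_of_mem_uniqSeqSet hq hq3 hx k (g := x k - 1)
    (by simp only [Set.mem_insert_iff, Set.mem_singleton_iff]; omega) (by omega)
  have hb := abs_le.1 (abs_baseVal_le hq fun i => hx.1 (k + 1 + i))
  push_cast at hlt
  rcases lt_abs.1 hlt with h | h <;> linarith

lemma neg_digit_mem (hx : ∀ i, x i ∈ ({-1, 0, 1} : Set ℤ)) (i : ℕ) :
    -x i ∈ ({-1, 0, 1} : Set ℤ) := by
  have : x i = -1 ∨ x i = 0 ∨ x i = 1 := by simpa using hx i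
  simp only [Set.mem_insert_iff, Set.mem_singleton_iff]
  omega

/-- If the digit sequence of the unique expansion of `1` is shifted to `{-1, 0, 1}`, it lies
lexicographically above `lam`. -/
lemma lexLEUpTo_lam_of_mem_uniqSeqSet (hq : 1 < q) (hq3 : q ≤ 3) (hx : x ∈ uniqSeqSet q)
    (hval : baseVal q x = 1 - 1 / (q - 1)) (N : ℕ) :
    LexLEUpTo N (fun i => lam (i + 1)) x := by
  have hR : 1 ≤ 2 * (1 / (q - 1)) := by
    rw [mul_one_div, le_div_iff₀ (by linarith)]
    linarith
  refine lexLEUpTo_lam_of_admissible hx.1 ?_ ?_ ?_ N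
  · intro k N hk j _ hagree
    by_contra! hlt
    have hd := baseVal_sub_of_agree' hq (fun i => hx.1 (k + 1 + i)) hx.1 j hagree
    have h1 := baseVal_tail_lt hq hq3 hx k hk
    have hle := hx.1 j
    have hm := hx.1 (k + 1 + j)
    simp only [Set.mem_insert_iff, Set.mem_singleton_iff] at hle hm hlt
    have h2 := baseVal_tail_lt hq hq3 hx j (by omega)
    have h3 := lt_baseVal_tail hq hq3 hx (k + 1 + j) (by omega)
    have h4 : (x j : ℝ) + 1 ≤ x (k + 1 + j) := by exact_mod_cast hlt
    rw [add_assoc (k + 1) j 1] at h3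
    simp only [add_assoc] at hd h1 h2 h3 h4
    have h5 : 0 ≤ baseVal q (fun i => x (k + (1 + i))) - baseVal q x := by
      rw [hd]
      apply div_nonneg _ (by positivity)
      linarith
    linarith
  · intro k hk heq
    have h1 := baseVal_tail_lt hq hq3 hx k hk
    rw [heq, hval] at h1
    exact lt_irrefl _ h1
  · intro k N hk j _ hagree
    by_contra! hlt
    have hd := baseVal_sub_of_agree' hq (neg_digit_mem hx.1) (fun i => hx.1 (k + 1 + i)) j hagree
    rw [baseVal_neg, baseVal_neg] at hd
    have h1 := lt_baseVal_tail hq hq3 hx k hk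
    have hle := hx.1 j
    have hm := hx.1 (k + 1 + j)
    simp only [Set.mem_insert_iff, Set.mem_singleton_iff] at hle hm hlt
    have h2 := baseVal_tail_lt hq hq3 hx j (by omega)
    have h3 := baseVal_tail_lt hq hq3 hx (k + 1 + j) (by omega)
    have h4 : (x (k + 1 + j) : ℝ) + 1 ≤ -x j := by exact_mod_cast hlt
    rw [add_assoc (k + 1) j 1] at h3
    push_cast at hd
    simp only [add_assoc] at hd h1 h2 h3 h4
    have h5 : 0 ≤ -baseVal q x - baseVal q (fun i => x (k + (1 + i))) := by
      rw [hd]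
      apply div_nonneg _ (by positivity)
      linarith
    linarith

/-- If all tails of `x` are lexicographically at most `y` on sufficiently many digits, and the
value of `y` is less than `1 - 1 / (q - 1)`, so is the value of every tail of `x`. -/
lemma baseVal_tail_lt_of_lexLE {N : ℕ} (hq : 1 < q) (hx : ∀ i, x i ∈ ({-1, 0, 1} : Set ℤ))
    (hy : ∀ i, y i ∈ ({-1, 0, 1} : Set ℤ)) (hval : baseVal q y < 1 - 1 / (q - 1))
    (hN : 2 * (1 / (q - 1)) / q ^ N < 1 - 1 / (q - 1) - baseVal q y)
    (hlex : ∀ k, LexLEUpTo N (fun i => x (k + 1 + i)) y) (k : ℕ) :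
    baseVal q (fun i => x (k + 1 + i)) < 1 - 1 / (q - 1) := by
  set C := 1 - 1 / (q - 1) with hC
  have hbd : ∀ k, |baseVal q (fun i => x (k + 1 + i))| ≤ 1 / (q - 1) := fun k =>
    abs_baseVal_le hq fun i => hx (k + 1 + i)
  have step : ∀ k, baseVal q (fun i => x (k + 1 + i)) < C ∨
      ∃ l j, baseVal q (fun i => x (k + 1 + i)) - baseVal q y ≤
        (baseVal q (fun i => x (l + 1 + i)) - C) / q ^ (j + 1) := by
    intro k
    by_cases hagree : ∀ i < N, x (k + 1 + i) = y i
    · left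
      have h := baseVal_sub_of_agree hq (fun i => hx (k + 1 + i)) hy N hagree
      have h1 := abs_le.1 (abs_baseVal_le hq fun i => hx (k + 1 + (N + i)))
      have h2 := abs_le.1 (abs_baseVal_le hq fun i => hy (N + i))
      have h3 : baseVal q (fun i => x (k + 1 + i)) - baseVal q y ≤
          2 * (1 / (q - 1)) / q ^ N := by
        rw [h]
        gcongr
        linarith
      linarith
    · right
      push Not at hagree
      classical
      obtain ⟨j, ⟨hjN, hj⟩, hmin⟩ :
          ∃ j, (j < N ∧ x (k + 1 + j) ≠ y j) ∧ ∀ i < j, x (k + 1 + i) = y i :=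
        ⟨Nat.find hagree, Nat.find_spec hagree, fun i hi => by
          have := (Nat.find_spec hagree).1
          by_contra hne
          exact Nat.find_min hagree hi ⟨by omega, hne⟩⟩
      have hlt : x (k + 1 + j) < y j := lt_of_le_of_ne (hlex k j hjN hmin) hj
      refine ⟨k + 1 + j, j, ?_⟩
      rw [baseVal_sub_of_agree' hq (fun i => hx (k + 1 + i)) hy j hmin]
      have h2 := abs_le.1 (abs_baseVal_le hq fun i => hy (j + 1 + i))
      have h4 : (x (k + 1 + j) : ℝ) + 1 ≤ y j := by exact_mod_cast hlt
      have h5 : (fun i => x (k + 1 + (j + 1 + i))) = fun i => x (k + 1 + j + 1 + i) :=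
        funext fun i => by congr 1; ring
      rw [h5]
      gcongr
      linarith
  have hrec : ∀ K : ℝ, 0 ≤ K → (∀ k, baseVal q (fun i => x (k + 1 + i)) - C ≤ K) → ∀ k,
      baseVal q (fun i => x (k + 1 + i)) < C ∨
      baseVal q (fun i => x (k + 1 + i)) - C ≤ K / q - (C - baseVal q y) := by
    intro K hK h k
    refine (step k).imp_right ?_
    rintro ⟨l, j, hlj⟩
    have : (baseVal q (fun i => x (l + 1 + i)) - C) / q ^ (j + 1) ≤ K / q := by
      calc _ ≤ K / q ^ (j + 1) := by gcongr; exact h l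
        _ ≤ K / q := by
          gcongr
          exact le_self_pow₀ hq.le (by omega)
    linarith
  have hdecay : ∀ m : ℕ, ∀ k, baseVal q (fun i => x (k + 1 + i)) - C ≤
      (1 / (q - 1) + |C|) / q ^ m := by
    have hpos : 0 < q - 1 := by linarith
    intro m
    induction m with
    | zero =>
      intro k
      have := abs_le.1 (hbd k)
      have := neg_abs_le C
      simp only [pow_zero, div_one]
      linarith
    | succ m ih =>
      intro k
      have hnn : 0 ≤ (1 / (q - 1) + |C|) / q ^ (m + 1) := by positivity
      rcases hrec _ (by positivity) ih k with h | h
      · linarith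
      · rw [div_div, ← pow_succ] at h
        linarith
  have hlim : Tendsto (fun m : ℕ => (1 / (q - 1) + |C|) / q ^ m) atTop (nhds 0) :=
    (tendsto_pow_atTop_atTop_of_one_lt hq).const_div_atTop _
  have hle : ∀ k, baseVal q (fun i => x (k + 1 + i)) - C ≤ 0 := fun k =>
    ge_of_tendsto' hlim fun m => hdecay m k
  rcases hrec 0 le_rfl hle k with h | h
  · exact h
  · rw [zero_div] at h
    linarith

end Digits

/-- The unique expansion of `1` over `{0, 1, 2}`, shifted to `{-1, 0, 1}`. -/
lemma exists_mem_uniqSeqSet_of_uniqueOneExp {p : ℝ} (hp : 1 < p) (h : uniqueOneExp p) :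
    ∃ d ∈ uniqSeqSet p, baseVal p d = 1 - 1 / (p - 1) := by
  obtain ⟨c, ⟨hc2, hc⟩, huniq⟩ := h
  have hd : ∀ i, (c i : ℤ) - 1 ∈ ({-1, 0, 1} : Set ℤ) := fun i => by
    have := hc2 i
    simp only [Set.mem_insert_iff, Set.mem_singleton_iff]
    omega
  have hval : baseVal p (fun i => (c i : ℤ) - 1) = 1 - 1 / (p - 1) := by
    have := (hasSum_digit_add_one hp hd).tsum_eq
    push_cast at this
    simp only [sub_add_cancel] at this
    rw [← hc] at this
    linarith
  refine ⟨fun i => (c i : ℤ) - 1, ⟨hd, fun s hs hsv => ?_⟩, hval⟩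
  have hs' : ∀ i, s i = -1 ∨ s i = 0 ∨ s i = 1 := fun i => by simpa using hs i
  have hcast : ∀ i, (((s i + 1).toNat : ℕ) : ℤ) = s i + 1 := fun i => by
    have := hs' i
    omega
  have heq := huniq (fun i => (s i + 1).toNat) ⟨fun i => by
    have := hs' i
    simp only
    omega, by
    have h1 := (hasSum_digit_add_one hp hs).tsum_eq
    have h2 : baseVal p s = 1 - 1 / (p - 1) := Eq.trans hsv hval
    rw [h2, sub_add_cancel] at h1
    rw [← h1]
    congr 1
    funext i
    congr 1
    exact_mod_cast (hcast i).symm⟩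
  funext i
  have := congrFun heq i
  have := hcast i
  simp only at *
  omega

lemma baseVal_lt_of_base_lt {p q : ℝ} (hp : 1 < p) (hpq : p < q) {d : ℕ → ℤ}
    (hd : ∀ i, d i ∈ ({-1, 0, 1} : Set ℤ)) (hval : baseVal p d = 1 - 1 / (p - 1)) :
    baseVal q d < 1 - 1 / (q - 1) := by
  have hP := hasSum_digit_add_one hp hd
  have hQ := hasSum_digit_add_one (hp.trans hpq) hd
  rw [hval, sub_add_cancel] at hP
  have hnn : ∀ i, 0 ≤ (d i : ℝ) + 1 := fun i => by
    have := (abs_le.1 (abs_digit_le hd i)).1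
    linarith
  obtain ⟨i, hi⟩ : ∃ i, (d i : ℝ) + 1 ≠ 0 := by
    by_contra! h
    simp only [h, zero_div] at hP
    exact zero_ne_one (hasSum_zero.unique hP)
  have hlt := hasSum_lt (i := i) (fun j => by
    have := hnn j
    simp only
    gcongr) (by
    have : 0 < (d i : ℝ) + 1 := lt_of_le_of_ne (hnn i) hi.symm
    gcongr) hQ hP
  linarith

/-! ### The block sequences -/

lemma getD_cons_lam (e : ℤ) (n i : ℕ) (h0 : 0 < i) (hi : i < 2 ^ n) :
    (e :: ((List.range (2 ^ n - 1)).map fun i => lam (i + 1))).getD i 0 = lam i := by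
  obtain ⟨k, rfl⟩ : ∃ k, i = k + 1 := ⟨i - 1, by omega⟩
  rw [List.getD_cons_succ, List.getD_eq_getElem _ _ (by simp; omega)]
  simp

lemma getD_reflect (w : List ℤ) (i : ℕ) : (reflect w).getD i 0 = -w.getD i 0 := by
  rw [reflect, ← neg_zero, List.getD_map, neg_zero]

/-- The type of a block: `0` for `a_n`, `b_n` and `1` for their reflections. -/
def blockType (w : List ℤ) : ℤ := if w.getD 1 0 = 1 then 0 else 1

lemma blockType_zero_or_one (w : List ℤ) : blockType w = 0 ∨ blockType w = 1 := by
  unfold blockType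
  split_ifs <;> simp

section Blocks

variable {n : ℕ}

lemma blockType_cons_lam (hn : n ≠ 0) (e : ℤ) :
    blockType (e :: ((List.range (2 ^ n - 1)).map fun i => lam (i + 1))) = 0 := by
  rw [blockType, getD_cons_lam e n 1 one_pos (Nat.one_lt_two_pow hn), lam_one, if_pos rfl]

lemma blockType_reflect_cons_lam (hn : n ≠ 0) (e : ℤ) :
    blockType (reflect (e :: ((List.range (2 ^ n - 1)).map fun i => lam (i + 1)))) = 1 := by
  rw [blockType, getD_reflect, getD_cons_lam e n 1 one_pos (Nat.one_lt_two_pow hn), lam_one,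
    if_neg (by norm_num)]

lemma getD_block (hn : n ≠ 0) {w : List ℤ}
    (hw : w ∈ ({aword n, bword n, reflect (aword n), reflect (bword n)} : Set (List ℤ)))
    {i : ℕ} (h0 : 0 < i) (hi : i < 2 ^ n) : w.getD i 0 = (1 - 2 * blockType w) * lam i := by
  rcases hw with rfl | rfl | rfl | rfl
  · rw [aword, blockType_cons_lam hn, getD_cons_lam _ n i h0 hi]
    ring
  · rw [bword, blockType_cons_lam hn, getD_cons_lam _ n i h0 hi]
    ring
  · rw [aword, blockType_reflect_cons_lam hn, getD_reflect, getD_cons_lam _ n i h0 hi]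
    ring
  · rw [bword, blockType_reflect_cons_lam hn, getD_reflect, getD_cons_lam _ n i h0 hi]
    ring

lemma getD_zero_of_allowedTrans (hn : n ≠ 0) {u v : List ℤ} (h : allowedTrans n u v) :
    v.getD 0 0 = blockType u + blockType v - 1 := by
  have ha : blockType (aword n) = 0 := blockType_cons_lam hn 0
  have hb : blockType (bword n) = 0 := blockType_cons_lam hn (-1)
  have ha' : blockType (reflect (aword n)) = 1 := blockType_reflect_cons_lam hn 0
  have hb' : blockType (reflect (bword n)) = 1 := blockType_reflect_cons_lam hn (-1)
  rcases h with ⟨rfl, rfl | rfl⟩ | ⟨rfl, rfl⟩ | ⟨rfl, rfl | rfl⟩ | ⟨rfl, rfl⟩ <;>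
    simp only [ha, hb, ha', hb'] <;> simp [aword, bword, reflect]

lemma getD_mem_of_mem_blocks {w : List ℤ}
    (hw : w ∈ ({aword n, bword n, reflect (aword n), reflect (bword n)} : Set (List ℤ)))
    (hn : n ≠ 0) {i : ℕ} (hi : i < 2 ^ n) : w.getD i 0 ∈ ({-1, 0, 1} : Set ℤ) := by
  rcases i.eq_zero_or_pos with rfl | h0
  · rcases hw with rfl | rfl | rfl | rfl <;> simp [aword, bword, reflect]
  · rw [getD_block hn hw h0 hi]
    have h : lam i = -1 ∨ lam i = 0 ∨ lam i = 1 := by simpa using lam_mem i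
    rcases blockType_zero_or_one w with h' | h' <;> rw [h'] <;>
      simp only [Set.mem_insert_iff, Set.mem_singleton_iff] <;> omega

/-- A block sequence is the difference sequence of an image under the Thue–Morse substitution. -/
lemma blocks_eq_tmSubst_sub (hn : Odd n) {B : ℕ → List ℤ}
    (hB : ∀ k, B k ∈ ({aword n, bword n, reflect (aword n), reflect (bword n)} : Set (List ℤ)))
    (hT : ∀ k, allowedTrans n (B k) (B (k + 1))) (j : ℕ) :
    (B ((j + 1) / 2 ^ n)).getD ((j + 1) % 2 ^ n) 0 =
      tmSubst (fun k => blockType (B k)) n (j + 1) - tmSubst (fun k => blockType (B k)) n j := by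
  have hn0 : n ≠ 0 := by
    rintro rfl
    simp at hn
  have hpos : 0 < 2 ^ n := by positivity
  have hj := Nat.div_add_mod (j + 1) (2 ^ n)
  have hlt := Nat.mod_lt (j + 1) hpos
  generalize (j + 1) / 2 ^ n = k at *
  generalize (j + 1) % 2 ^ n = i at *
  rcases i.eq_zero_or_pos with rfl | h0
  · obtain ⟨k, rfl⟩ : ∃ l, k = l + 1 := Nat.exists_eq_succ_of_ne_zero (by rintro rfl; simp at hj)
    have hj' : j = 2 ^ n * k + (2 ^ n - 1) := by
      rw [mul_add] at hj
      omega
    rw [← hj, hj', tmSubst_apply _ _ _ _ hpos, tmSubst_apply _ _ _ _ (by omega),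
      tm_two_pow_sub_one, Nat.odd_iff.1 hn, getD_zero_of_allowedTrans hn0 (hT k), tm_zero]
    push_cast
    ring
  · obtain ⟨i, rfl⟩ : ∃ l, i = l + 1 := Nat.exists_eq_succ_of_ne_zero h0.ne'
    obtain rfl : j = 2 ^ n * k + i := by omega
    rw [← hj, tmSubst_apply _ _ _ _ hlt, tmSubst_apply _ _ _ _ (by omega),
      getD_block hn0 (hB k) h0 hlt, lam_succ]
    ring

end Blocks

theorem stmt17 (qKL q : ℝ) (h1 : 1 < qKL) (h2 : uniqueOneExp qKL)
    (h3 : ∀ p, 1 < p → uniqueOneExp p → qKL ≤ p) (hq : q ∈ Set.Ioo qKL 3) :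
    ∃ n : ℕ, ∀ B : ℕ → List ℤ,
      (∀ k, B k ∈ ({aword n, bword n, reflect (aword n), reflect (bword n)} :
        Set (List ℤ))) →
      (∀ k, allowedTrans n (B k) (B (k + 1))) →
      (fun i => (B (i / 2 ^ n)).getD (i % 2 ^ n) 0) ∈ uniqSeqSet q := by
  obtain ⟨hpq, hq3⟩ := hq
  have hq1 : 1 < q := h1.trans hpq
  obtain ⟨d, hd, hval⟩ := exists_mem_uniqSeqSet_of_uniqueOneExp h1 h2
  have hlamd := lexLEUpTo_lam_of_mem_uniqSeqSet h1 (hpq.trans hq3).le hd hval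
  have hvq := baseVal_lt_of_base_lt h1 hpq hd.1 hval
  have hlim : Tendsto (fun m : ℕ => 2 * (1 / (q - 1)) / q ^ m) atTop (nhds 0) :=
    (tendsto_pow_atTop_atTop_of_one_lt hq1).const_div_atTop _
  obtain ⟨N, hN⟩ := eventually_atTop.1 (hlim.eventually_lt_const (sub_pos.2 hvq))
  refine ⟨2 * N + 1, fun B hB hT => ?_⟩
  set n := 2 * N + 1 with hn
  have hM := hN (2 ^ n - 1) (by have := Nat.lt_two_pow_self (n := n); omega)
  have hpos : 0 < 2 ^ n := by positivity
  set s : ℕ → ℤ := fun k => blockType (B k)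
  have hs : ∀ k, s k = 0 ∨ s k = 1 := fun k => blockType_zero_or_one (B k)
  have hs' : ∀ k, 1 - s k = 0 ∨ 1 - s k = 1 := fun k => by have := hs k; omega
  set x : ℕ → ℤ := fun i => (B (i / 2 ^ n)).getD (i % 2 ^ n) 0
  have hdig : ∀ i, x i ∈ ({-1, 0, 1} : Set ℤ) := fun i =>
    getD_mem_of_mem_blocks (hB _) (by omega) (Nat.mod_lt _ hpos)
  have hdiff : ∀ j, x (j + 1) = tmSubst s n (j + 1) - tmSubst s n j :=
    blocks_eq_tmSubst_sub ⟨N, rfl⟩ hB hT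
  have hM1 : 2 ^ n - 1 + 1 = 2 ^ n := by omega
  have hupper := baseVal_tail_lt_of_lexLE hq1 hdig hd.1 hvq hM fun k =>
    (lexLEUpTo_lam_of_tmBounded (tmSubst_zero_or_one hs n)
      (hM1.symm ▸ tmBounded_tmSubst hs n) hdiff k).trans (hlamd _)
  have hlower := baseVal_tail_lt_of_lexLE hq1 (neg_digit_mem hdig) hd.1 hvq hM fun k =>
    (lexLEUpTo_lam_of_tmBounded (x := fun i => -x i) (tmSubst_zero_or_one hs' n)
      (hM1.symm ▸ tmBounded_tmSubst hs' n) (fun j => by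
        rw [hdiff, tmSubst_one_sub, tmSubst_one_sub]
        ring) k).trans (hlamd _)
  refine mem_uniqSeqSet_of_abs_lt hq1 hdig fun k => abs_lt.2 ⟨?_, hupper k⟩
  have := hlower k
  rw [baseVal_neg] at this
  linarith

end
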